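/- Let Y be a random variable on Ω satisfying distributional consistency. Then Y satisfies ignorability if and only if Y ⊥ (T*, F_T) | T, i.e. if and only if for every regime r ∈ {0, 1, e}, all t, t* ∈ {0,1} with μ_r(T = t, T* = t*) > 0, and every measurable set A, μ_r(Y ∈ A | T = t, T* = t*) = μ_t(Y ∈ A). (Corollary 1.) -/

import Mathlib

open MeasureTheory ProbabilityTheory

theorem ProbabilityTheory.cond_congr_set_ae {Ω : Type*} [MeasurableSpace Ω] {μ : Measure Ω}
    {s t : Set Ω} (h : s =ᵐ[μ] t) : μ[|s] = μ[|t] := by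
  simp only [ProbabilityTheory.cond, measure_congr h, Measure.restrict_congr_set h]

/-- **Corollary 1.** In a three-regime treatment model, if `Y` satisfies
distributional consistency, then `Y` satisfies ignorability if and only if
`Y ⫫ (T*, F_T) | T`: in every regime, conditionally on `(T = t, T* = t*)`, the
distribution of `Y` equals the marginal distribution of `Y` in the interventional
regime `μ_t`. -/
theorem dt_ignorability_iff_Y_indep_Tstar_regime_given_T
    {Ω : Type*} [MeasurableSpace Ω] {β : Type*} [MeasurableSpace β]
    (μ0 μ1 μe : Measure Ω)
    [IsProbabilityMeasure μ0] [IsProbabilityMeasure μ1] [IsProbabilityMeasure μe]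
    (T Tstar : Ω → Bool) (hT : Measurable T) (hTstar : Measurable Tstar)
    (hT0 : ∀ᵐ ω ∂μ0, T ω = false)
    (hT1 : ∀ᵐ ω ∂μ1, T ω = true)
    (hTe : ∀ᵐ ω ∂μe, T ω = Tstar ω)
    (hTstarDist : ∀ t : Bool,
      μ0 {ω | Tstar ω = t} = μe {ω | Tstar ω = t} ∧
      μ1 {ω | Tstar ω = t} = μe {ω | Tstar ω = t})
    (Y : Ω → β) (hY : Measurable Y)
    (hDC : ∀ t : Bool, 0 < μe {ω | Tstar ω = t} →
      ∀ A : Set β, MeasurableSet A →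
        μe[|{ω | Tstar ω = t}] {ω | Y ω ∈ A} =
          (bif t then μ1 else μ0)[|{ω | Tstar ω = t}] {ω | Y ω ∈ A}) :
    (∀ t tstar : Bool, 0 < (bif t then μ1 else μ0) {ω | Tstar ω = tstar} →
      ∀ A : Set β, MeasurableSet A →
        (bif t then μ1 else μ0)[|{ω | Tstar ω = tstar}] {ω | Y ω ∈ A} =
          (bif t then μ1 else μ0) {ω | Y ω ∈ A})
    ↔
    (∀ μr ∈ ({μ0, μ1, μe} : Set (Measure Ω)), ∀ t tstar : Bool,
      0 < μr {ω | T ω = t ∧ Tstar ω = tstar} →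
      ∀ A : Set β, MeasurableSet A →
        μr[|{ω | T ω = t ∧ Tstar ω = tstar}] {ω | Y ω ∈ A} =
          (bif t then μ1 else μ0) {ω | Y ω ∈ A}) := by
  have hTt : ∀ t : Bool, ∀ᵐ ω ∂(bif t then μ1 else μ0), T ω = t := by
    rintro (_ | _)
    exacts [hT0, hT1]
  have hset : ∀ t tstar : Bool, {ω | T ω = t ∧ Tstar ω = tstar}
      =ᵐ[bif t then μ1 else μ0] {ω | Tstar ω = tstar} := fun t tstar ↦ by
    filter_upwards [hTt t] with ω hω
    exact propext (and_iff_right hω)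
  have hmem : ∀ t : Bool, (bif t then μ1 else μ0) ∈ ({μ0, μ1, μe} : Set (Measure Ω)) := by
    rintro (_ | _) <;> simp
  constructor
  · intro hI
    have interventional : ∀ r t tstar : Bool,
        0 < (bif r then μ1 else μ0) {ω | T ω = t ∧ Tstar ω = tstar} →
        ∀ A : Set β, MeasurableSet A →
          (bif r then μ1 else μ0)[|{ω | T ω = t ∧ Tstar ω = tstar}] {ω | Y ω ∈ A} =
            (bif t then μ1 else μ0) {ω | Y ω ∈ A} := by
      intro r t tstar hpos A hA
      obtain rfl : r = t := by
        by_contra hne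
        refine hpos.ne' (measure_eq_zero_iff_ae_notMem.2 ?_)
        filter_upwards [hTt r] with ω hω h
        exact hne (hω.symm.trans h.1)
      rw [measure_congr (hset r tstar)] at hpos
      rw [cond_congr_set_ae (hset r tstar)]
      exact hI r tstar hpos A hA
    rintro μr (rfl | rfl | rfl) t tstar hpos A hA
    · exact interventional false t tstar hpos A hA
    · exact interventional true t tstar hpos A hA
    · obtain rfl : t = tstar := by
        by_contra hne
        refine hpos.ne' (measure_eq_zero_iff_ae_notMem.2 ?_)
        filter_upwards [hTe] with ω hω h
        exact hne (h.1.symm.trans (hω.trans h.2))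
      have hidle : {ω | T ω = t ∧ Tstar ω = t} =ᵐ[μr] {ω | Tstar ω = t} := by
        filter_upwards [hTe] with ω hω
        exact propext (and_iff_right_of_imp hω.trans)
      rw [measure_congr hidle] at hpos
      rw [cond_congr_set_ae hidle, hDC t hpos A hA]
      refine hI t t ?_ A hA
      cases t
      · exact (hTstarDist false).1 ▸ hpos
      · exact (hTstarDist true).2 ▸ hpos
  · intro h t tstar hpos A hA
    rw [← measure_congr (hset t tstar)] at hpos
    rw [← cond_congr_set_ae (hset t tstar)]
    exact h _ (hmem t) t tstar hpos A hA
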